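/- arXiv:2308.02316 — 2 statements merged into one kernel-verified Lean document; each statement's English description precedes it below -/
import Mathlib

section
/- Let Θ ∈ ℂ^{(τ₂K+D)×MD} be a block matrix whose blocks are F_i = M_i · (I_D ⊗ x_iᵀ) for i = 1, …, τ₂ (where M_i ∈ ℂ^{K×D} and x_i ∈ ℂ^M are arbitrary) together with one block F = I_D ⊗ xᵀ (x ∈ ℂ^M). Then rank(Θ) ≤ (τ₂+1)·D. Consequently, if τ₂ < M−1, the map g ↦ Θg on ℂ^{MD} is not injective, so the BS cannot uniquely recover g with fewer than M−1 time samples in Step 2. -/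
/-- The Step-2 observation matrix `Θ`, built from blocks `F_i = M_i · (I_D ⊗ x_iᵀ)` for
`i = 1,…,τ₂` together with one block `F = I_D ⊗ xᵀ`, has rank at most `(τ₂+1)·D`
(entrywise, `F_i (k,(d,m)) = (M_i)_{k,d} · (x_i)_m` and `F (d',(d,m)) = δ_{d',d} x_m`).
Consequently, if `τ₂ < M−1`, the map `g ↦ Θ g` on `ℂ^{MD}` is not injective. -/
theorem stmt_5 (τ₂ K D M : ℕ) (hD : 0 < D)
    (Mi : Fin τ₂ → Matrix (Fin K) (Fin D) ℂ)
    (x : Fin τ₂ → Fin M → ℂ) (x₀ : Fin M → ℂ)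
    (Θ : Matrix ((Fin τ₂ × Fin K) ⊕ Fin D) (Fin D × Fin M) ℂ)
    (hΘ₁ : ∀ i k d m, Θ (Sum.inl (i, k)) (d, m) = Mi i k d * x i m)
    (hΘ₂ : ∀ d' d m, Θ (Sum.inr d') (d, m) = if d' = d then x₀ m else 0) :
    Θ.rank ≤ (τ₂ + 1) * D ∧
      (τ₂ < M - 1 → ¬ Function.Injective (fun g : Fin D × Fin M → ℂ => Θ.mulVec g)) := by
  have hrank : Θ.rank ≤ (τ₂ + 1) * D := by
    let B : Matrix (Option (Fin τ₂) × Fin D) (Fin D × Fin M) ℂ :=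
      Matrix.of fun p q => if p.2 = q.1 then (p.1.elim x₀ x) q.2 else 0
    let A : Matrix ((Fin τ₂ × Fin K) ⊕ Fin D) (Option (Fin τ₂) × Fin D) ℂ :=
      Matrix.of fun r p => Sum.elim
        (fun ik : Fin τ₂ × Fin K => if p.1 = some ik.1 then Mi ik.1 ik.2 p.2 else 0)
        (fun d' => if p.1 = none then (if d' = p.2 then 1 else 0) else 0) r
    have hAB : Θ = A * B := by
      ext r q
      obtain ⟨d, m⟩ := q
      rcases r with ⟨i, k⟩ | d'
      · rw [hΘ₁]
        simp [A, B, Matrix.mul_apply, Fintype.sum_prod_type, Fintype.sum_option]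
      · rw [hΘ₂]
        simp [A, B, Matrix.mul_apply, Fintype.sum_prod_type, Fintype.sum_option]
    rw [hAB]
    refine (Matrix.rank_mul_le_right A B).trans ((Matrix.rank_le_card_height B).trans ?_)
    simp
  refine ⟨hrank, fun hτ hinj => ?_⟩
  have h : Θ.rank = D * M := by
    have := LinearMap.finrank_range_of_inj (f := Θ.mulVecLin) hinj
    rw [Matrix.rank, this]
    simp
  rw [h, mul_comm D M] at hrank
  have := Nat.le_of_mul_le_mul_right hrank hD
  omega
end

section
/- Let u > 0, s > 0, and η > 0 be real numbers. The function L(q) = (u²/(u+s)²)·q + η·log₂(1 + u/q) on (0,∞) is convex; its derivative is L'(q) = u²/(u+s)² − η·u/((u+q)·q·ln 2); and L has a unique global minimizer on (0,∞), given in closed form by q̄ = (1/2)·( −u + √( u² + 4η(s+u)²/(u·ln 2) ) ), which is the unique positive solution of the stationarity equation η·u/((u+q)·q·ln 2) = u²/(u+s)². -/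
/-- The per-sample Lagrangian of the MM subproblem for quantization bit allocation. -/
noncomputable def lagrangianL (u s η q : ℝ) : ℝ :=
  u ^ 2 / (u + s) ^ 2 * q + η * Real.logb 2 (1 + u / q)

/-- The closed-form minimizer `q̄ = (−u + √(u² + 4η(s+u)²/(u·ln 2)))/2`. -/
noncomputable def qBar (u s η : ℝ) : ℝ :=
  (1 / 2) * (-u + Real.sqrt (u ^ 2 + 4 * η * (s + u) ^ 2 / (u * Real.log 2)))

/-- `L(q) = (u²/(u+s)²)·q + η·log₂(1+u/q)` is convex on `(0,∞)`, has derivative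
`u²/(u+s)² − η·u/((u+q)·q·ln 2)`, and a unique global minimizer on `(0,∞)` given in
closed form by `q̄`, which is the unique positive solution of the stationarity equation
`η·u/((u+q)·q·ln 2) = u²/(u+s)²`. -/
theorem stmt_16 (u s η : ℝ) (hu : 0 < u) (hs : 0 < s) (hη : 0 < η) :
    ConvexOn ℝ (Set.Ioi (0 : ℝ)) (lagrangianL u s η) ∧
      (∀ q ∈ Set.Ioi (0 : ℝ),
        HasDerivAt (lagrangianL u s η)
          (u ^ 2 / (u + s) ^ 2 - η * u / ((u + q) * q * Real.log 2)) q) ∧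
      qBar u s η ∈ Set.Ioi (0 : ℝ) ∧
      (∀ q ∈ Set.Ioi (0 : ℝ), q ≠ qBar u s η →
        lagrangianL u s η (qBar u s η) < lagrangianL u s η q) ∧
      (∀ q ∈ Set.Ioi (0 : ℝ),
        (η * u / ((u + q) * q * Real.log 2) = u ^ 2 / (u + s) ^ 2 ↔ q = qBar u s η)) := by
  have hl : 0 < Real.log 2 := Real.log_pos (by norm_num)
  have hder : ∀ q ∈ Set.Ioi (0 : ℝ),
        HasDerivAt (lagrangianL u s η)
          (u ^ 2 / (u + s) ^ 2 - η * u / ((u + q) * q * Real.log 2)) q := by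
    intro q hq
    have hq' : 0 < q := hq
    have hpos : 0 < 1 + u / q := by positivity
    have h1 : HasDerivAt (fun x : ℝ => 1 + u / x) (u * (-(q ^ 2)⁻¹)) q := by
      simpa [div_eq_mul_inv] using ((hasDerivAt_inv hq'.ne').const_mul u).const_add 1
    have h2 := ((h1.log hpos.ne').div_const (Real.log 2)).const_mul η
    have h3 := ((hasDerivAt_id q).const_mul (u ^ 2 / (u + s) ^ 2)).add h2
    have h4 : HasDerivAt (lagrangianL u s η) _ q := h3
    convert h4 using 1
    have : u + q ≠ 0 := by positivity
    have : q + u ≠ 0 := by positivity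
    have : u + s ≠ 0 := by positivity
    field_simp
    ring
  have hmono : StrictMonoOn (fun q : ℝ => u ^ 2 / (u + s) ^ 2 - η * u / ((u + q) * q * Real.log 2))
      (Set.Ioi 0) := by
    intro a ha b hb hab
    have ha' : 0 < a := ha
    have hb' : 0 < b := hb
    have : η * u / ((u + b) * b * Real.log 2) < η * u / ((u + a) * a * Real.log 2) := by
      apply div_lt_div_of_pos_left (by positivity) (by positivity)
      gcongr
    simp only
    linarith
  have hcont : ContinuousOn (lagrangianL u s η) (Set.Ioi 0) :=
    fun q hq => (hder q hq).continuousAt.continuousWithinAt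
  have hdm : StrictMonoOn (deriv (lagrangianL u s η)) (Set.Ioi 0) :=
    hmono.congr (fun q hq => (hder q hq).deriv.symm)
  have hconv : StrictConvexOn ℝ (Set.Ioi (0 : ℝ)) (lagrangianL u s η) :=
    StrictMonoOn.strictConvexOn_of_deriv (convex_Ioi 0) hcont (by rwa [interior_Ioi])
  have hD : 0 < 4 * η * (s + u) ^ 2 / (u * Real.log 2) := by positivity
  have hqpos : 0 < qBar u s η := by
    unfold qBar
    have : u < Real.sqrt (u ^ 2 + 4 * η * (s + u) ^ 2 / (u * Real.log 2)) :=
      Real.lt_sqrt_of_sq_lt (by linarith)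
    linarith
  have hquad : (u + qBar u s η) * qBar u s η = η * (s + u) ^ 2 / (u * Real.log 2) := by
    have h := Real.sq_sqrt (show 0 ≤ u ^ 2 + 4 * η * (s + u) ^ 2 / (u * Real.log 2) by positivity)
    unfold qBar
    have e : 4 * η * (s + u) ^ 2 / (u * Real.log 2) = 4 * (η * (s + u) ^ 2 / (u * Real.log 2)) := by
      ring
    linear_combination (1 / 4) * h + (1 / 4) * e
  have hstat : η * u / ((u + qBar u s η) * qBar u s η * Real.log 2) = u ^ 2 / (u + s) ^ 2 := by
    rw [hquad]
    have : u + s ≠ 0 := by positivity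
    have : s + u ≠ 0 := by positivity
    field_simp
    try ring
  have hd0 : deriv (lagrangianL u s η) (qBar u s η) = 0 := by
    rw [(hder _ hqpos).deriv, hstat, sub_self]
  refine ⟨hconv.convexOn, hder, hqpos, ?_, ?_⟩
  · intro q hq hne
    rcases lt_or_gt_of_ne hne with h | h
    · have hanti : StrictAntiOn (lagrangianL u s η) (Set.Icc q (qBar u s η)) := by
        apply strictAntiOn_of_deriv_neg (convex_Icc _ _)
          (hcont.mono fun x hx => lt_of_lt_of_le hq hx.1)
        intro x hx
        rw [interior_Icc] at hx
        rw [← hd0]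
        exact hdm (lt_trans hq hx.1) hqpos hx.2
      exact hanti ⟨le_rfl, h.le⟩ ⟨h.le, le_rfl⟩ h
    · have hm : StrictMonoOn (lagrangianL u s η) (Set.Icc (qBar u s η) q) := by
        apply strictMonoOn_of_deriv_pos (convex_Icc _ _)
          (hcont.mono fun x hx => lt_of_lt_of_le hqpos hx.1)
        intro x hx
        rw [interior_Icc] at hx
        rw [← hd0]
        exact hdm hqpos (lt_trans hqpos hx.1) hx.1
      exact hm ⟨le_rfl, h.le⟩ ⟨h.le, le_rfl⟩ h
  · intro q hq
    constructor
    · intro h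
      apply hmono.injOn hq hqpos
      simp only
      rw [h, hstat]
    · rintro rfl
      exact hstat
end
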